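/- Let f : S³ → S⁶ be a smooth embedding whose image is disjoint from T. Then there exists a C^∞ map H : [0,1] × S³ → S⁶ such that each slice H_t = H(t, ·) is a smooth embedding with image disjoint from T, H₀ = f, and the image of H₁ is contained in the open upper hemisphere {x ∈ S⁶ : x₁ > 0}. -/

import Mathlib

/- STATEMENT 11: Let f : S³ → S⁶ be a smooth embedding whose image is disjoint
   from T. Then there is a C^∞ map H : [0,1] × S³ → S⁶ whose slices are smooth
   embeddings with images disjoint from T, with H₀ = f and H₁(S³) contained in
   the open upper hemisphere {x ∈ S⁶ : x₁ > 0}. -/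

open scoped Manifold

noncomputable section

abbrev E (n : ℕ) : Type := EuclideanSpace ℝ (Fin n)
abbrev Sph (n : ℕ) : Set (E (n + 1)) := Metric.sphere 0 1

/-- The standard torus `T ⊂ S⁶`. -/
def T : Set (E 7) :=
  {x | x ∈ Metric.sphere (0 : E 7) 1 ∧
       x 0 ^ 2 + x 1 ^ 2 + x 2 ^ 2 = 1 / 2 ∧ x 3 ^ 2 + x 4 ^ 2 = 1 / 2}

/-- A smooth embedding between spheres: a `C^∞` map which is a topological
embedding and whose differential is injective at every point. -/
def IsSmoothEmbedding {m n : ℕ} (f : Sph m → Sph n) : Prop :=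
  ContMDiff (𝓡 m) (𝓡 n) (⊤ : ℕ∞) f ∧ Topology.IsEmbedding f ∧
    ∀ x, Function.Injective (mfderiv (𝓡 m) (𝓡 n) f x)

open scoped ContDiff
open Set Metric

/-- A smooth family, parametrized by `[0, 1]`, of self-maps of the unit sphere of `E n`, given by
formulas on an ambient neighbourhood, each member having a differentiable left inverse. -/
structure IsSphereIsotopy {n : ℕ} (F : ℝ → E n → E n) : Prop where
  mapsTo : ∀ t ∈ Icc (0 : ℝ) 1, MapsTo (F t) (sphere 0 1) (sphere 0 1)
  contDiffAt : ∀ t ∈ Icc (0 : ℝ) 1, ∀ x ∈ sphere (0 : E n) 1,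
    ContDiffAt ℝ ∞ (fun p : ℝ × E n => F p.1 p.2) (t, x)
  exists_leftInverse : ∀ t ∈ Icc (0 : ℝ) 1, ∃ G : E n → E n, ∀ x ∈ sphere (0 : E n) 1,
    G (F t x) = x ∧ DifferentiableAt ℝ G (F t x)

theorem IsSphereIsotopy.comp {n : ℕ} {F F' : ℝ → E n → E n} (hF' : IsSphereIsotopy F')
    (hF : IsSphereIsotopy F) : IsSphereIsotopy fun t x => F' t (F t x) where
  mapsTo t ht := (hF'.mapsTo t ht).comp (hF.mapsTo t ht)
  contDiffAt t ht x hx := by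
    have h := hF'.contDiffAt t ht _ (hF.mapsTo t ht hx)
    exact ContDiffAt.comp (t, x) (f := fun p : ℝ × E n => (p.1, F p.1 p.2)) h
      (contDiffAt_fst.prodMk (hF.contDiffAt t ht x hx))
  exists_leftInverse t ht := by
    obtain ⟨G, hG⟩ := hF.exists_leftInverse t ht
    obtain ⟨G', hG'⟩ := hF'.exists_leftInverse t ht
    refine ⟨G ∘ G', fun x hx => ?_⟩
    obtain ⟨h1, h2⟩ := hG' _ (hF.mapsTo t ht hx)
    refine ⟨by rw [Function.comp_apply, h1, (hG x hx).1], DifferentiableAt.comp _ ?_ h2⟩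
    rw [h1]
    exact (hG x hx).2

/-- Composing a smooth embedding with a map of the ambient sphere which has a differentiable left
inverse gives a smooth embedding. -/
theorem IsSmoothEmbedding.of_leftInverse {m n : ℕ} {f h : Sph m → Sph n}
    (hf : IsSmoothEmbedding f) (hh : ContMDiff (𝓡 m) (𝓡 n) (⊤ : ℕ∞) h) (G : E (n + 1) → E (n + 1))
    (hG : ∀ x, G (h x) = f x ∧ DifferentiableAt ℝ G (h x)) : IsSmoothEmbedding h := by
  have : Fact (Module.finrank ℝ (E (n + 1)) = n + 1) := ⟨finrank_euclideanSpace_fin⟩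
  refine ⟨hh, ?_, fun x => ?_⟩
  · refine (hh.continuous.isClosedEmbedding fun x y hxy => hf.2.1.injective ?_).isEmbedding
    exact Subtype.ext (by rw [← (hG x).1, ← (hG y).1, hxy])
  · have hcoe : ∀ y : Sph n, MDifferentiableAt (𝓡 n) 𝓘(ℝ, E (n + 1))
        (Subtype.val : Sph n → E (n + 1)) y := fun y =>
      (contMDiff_coe_sphere (m := 1) y).mdifferentiableAt one_ne_zero
    have hfx : MDifferentiableAt (𝓡 m) (𝓡 n) f x := (hf.1 x).mdifferentiableAt (by simp)
    have hhx : MDifferentiableAt (𝓡 m) (𝓡 n) h x := (hh x).mdifferentiableAt (by simp)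
    have hGx : MDifferentiableAt 𝓘(ℝ, E (n + 1)) 𝓘(ℝ, E (n + 1)) G ((Subtype.val ∘ h) x) :=
      (hG x).2.mdifferentiableAt
    have hcomp : G ∘ (Subtype.val ∘ h) = Subtype.val ∘ f := funext fun y => (hG y).1
    have hinj : Function.Injective
        (mfderiv (𝓡 m) 𝓘(ℝ, E (n + 1)) ((Subtype.val : Sph n → E (n + 1)) ∘ f) x) := by
      rw [mfderiv_comp x (hcoe _) hfx]
      exact (injective_mvfderiv_subtypeVal_sphere (f x)).comp (hf.2.2 x)
    rw [← hcomp, mfderiv_comp x hGx ((hcoe _).comp x hhx), mfderiv_comp x (hcoe _) hhx] at hinj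
    exact Function.Injective.of_comp (f := mfderiv 𝓘(ℝ, E (n + 1)) 𝓘(ℝ, E (n + 1)) G (h x) ∘
      mfderiv (𝓡 n) 𝓘(ℝ, E (n + 1)) (Subtype.val : Sph n → E (n + 1)) (h x)) hinj

/-- An ambient isotopy of the sphere moves a smooth embedding through smooth embeddings. -/
theorem IsSphereIsotopy.exists_isotopy {m n : ℕ} {F : ℝ → E (n + 1) → E (n + 1)}
    (hF : IsSphereIsotopy F) {f : Sph m → Sph n} (hf : IsSmoothEmbedding f) :
    ∃ H : Icc (0 : ℝ) 1 × Sph m → Sph n,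
      ContMDiff ((𝓡∂ 1).prod (𝓡 m)) (𝓡 n) (⊤ : ℕ∞) H ∧
      (∀ t : Icc (0 : ℝ) 1, IsSmoothEmbedding fun x => H (t, x)) ∧
      ∀ t x, (H (t, x) : E (n + 1)) = F t (f x) := by
  have : Fact (Module.finrank ℝ (E (n + 1)) = n + 1) := ⟨finrank_euclideanSpace_fin⟩
  have hmem : ∀ p : Icc (0 : ℝ) 1 × Sph m, F p.1 (f p.2) ∈ sphere (0 : E (n + 1)) 1 :=
    fun p => hF.mapsTo p.1 p.1.2 (f p.2).2
  have hsmooth : ContMDiff ((𝓡∂ 1).prod (𝓡 m)) 𝓘(ℝ, E (n + 1)) ∞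
      fun p : Icc (0 : ℝ) 1 × Sph m => F p.1 (f p.2) := fun p => by
    have hpair : ContMDiff ((𝓡∂ 1).prod (𝓡 m)) 𝓘(ℝ, ℝ × E (n + 1)) ∞
        fun p : Icc (0 : ℝ) 1 × Sph m => ((p.1 : ℝ), (f p.2 : E (n + 1))) :=
      (contMDiff_subtypeVal_Icc.comp contMDiff_fst).prodMk_space
        (contMDiff_coe_sphere.comp (hf.1.comp contMDiff_snd))
    exact (hF.contDiffAt p.1 p.1.2 (f p.2) (f p.2).2).contMDiffAt.comp p (hpair p)
  have hH := hsmooth.codRestrict_sphere (n := n) hmem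
  refine ⟨_, hH, fun t => ?_, fun t x => rfl⟩
  obtain ⟨G, hG⟩ := hF.exists_leftInverse t t.2
  exact hf.of_leftInverse (hH.comp (contMDiff_const.prodMk contMDiff_id)) G
    fun x => hG (f x) (f x).2

theorem mem_unitSphere_iff {x : E 7} : x ∈ sphere (0 : E 7) 1 ↔
    x 0 ^ 2 + x 1 ^ 2 + x 2 ^ 2 + x 3 ^ 2 + x 4 ^ 2 + x 5 ^ 2 + x 6 ^ 2 = 1 := by
  rw [mem_sphere_zero_iff_norm, EuclideanSpace.norm_eq, Real.sqrt_eq_one]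
  simp [Fin.sum_univ_succ, add_assoc]

/-! ### Translations followed by radial projection -/

/-- The translation by `t • v`, followed by the radial projection to the unit sphere. -/
def radialTranslate {n : ℕ} (v : E n) (t : ℝ) (x : E n) : E n := ‖x + t • v‖⁻¹ • (x + t • v)

theorem norm_smul_lt_one {n : ℕ} {v : E n} (hv : ‖v‖ < 1) {t : ℝ} (ht : t ∈ Icc (0 : ℝ) 1) :
    ‖t • v‖ < 1 := by
  rw [norm_smul, Real.norm_of_nonneg ht.1]
  nlinarith [norm_nonneg v, ht.1, ht.2]

theorem add_ne_zero_of_norm_lt_one {n : ℕ} {w x : E n} (hw : ‖w‖ < 1)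
    (hx : x ∈ sphere (0 : E n) 1) : x + w ≠ 0 := by
  intro h
  rw [mem_sphere_zero_iff_norm, eq_neg_of_add_eq_zero_left h, norm_neg] at hx
  exact hw.ne hx

theorem isSphereIsotopy_radialTranslate {n : ℕ} {v : E n} (hv : ‖v‖ < 1) :
    IsSphereIsotopy (radialTranslate v) where
  mapsTo t ht x hx := by
    have h := add_ne_zero_of_norm_lt_one (norm_smul_lt_one hv ht) hx
    rw [mem_sphere_zero_iff_norm, radialTranslate, norm_smul, norm_inv, norm_norm,
      inv_mul_cancel₀ (norm_ne_zero_iff.2 h)]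
  contDiffAt t ht x hx := by
    have h := add_ne_zero_of_norm_lt_one (norm_smul_lt_one hv ht) hx
    have h1 : ContDiffAt ℝ ∞ (fun p : ℝ × E n => p.2 + p.1 • v) (t, x) := by fun_prop
    exact ((h1.norm ℝ h).inv (norm_ne_zero_iff.2 h)).smul h1
  exists_leftInverse t ht := by
    set w := t • v with hw
    have hw1 : ‖w‖ < 1 := norm_smul_lt_one hv ht
    refine ⟨fun q => (inner ℝ q w + √(inner ℝ q w ^ 2 + 1 - ‖w‖ ^ 2)) • q - w, fun x hx => ?_⟩
    have h := norm_ne_zero_iff.2 <| add_ne_zero_of_norm_lt_one hw1 hx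
    have hpos : 0 < ‖x + w‖ := (norm_nonneg _).lt_of_ne' h
    have hx1 : ‖x‖ = 1 := mem_sphere_zero_iff_norm.1 hx
    constructor
    · have hsq : ‖x + w‖ ^ 2 = 1 + 2 * inner ℝ x w + ‖w‖ ^ 2 := by
        rw [norm_add_sq_real, hx1, one_pow]
      have hinner : inner ℝ (radialTranslate v t x) w =
          ‖x + w‖⁻¹ * (inner ℝ x w + ‖w‖ ^ 2) := by
        rw [radialTranslate, ← hw, real_inner_smul_left, inner_add_left, real_inner_self_eq_norm_sq]
      have hxw : |inner ℝ x w| ≤ ‖w‖ := by simpa [hx1] using abs_real_inner_le_norm x w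
      have hroot : √(inner ℝ (radialTranslate v t x) w ^ 2 + 1 - ‖w‖ ^ 2) =
          ‖x + w‖⁻¹ * (1 + inner ℝ x w) := by
        rw [Real.sqrt_eq_iff_mul_self_eq_of_pos (mul_pos (inv_pos.2 hpos)
          (by linarith [neg_le_of_abs_le hxw])), hinner]
        field_simp
        rw [hsq]
        ring
      have hsum : inner ℝ (radialTranslate v t x) w +
          √(inner ℝ (radialTranslate v t x) w ^ 2 + 1 - ‖w‖ ^ 2) = ‖x + w‖ := by
        rw [hroot, hinner]
        field_simp
        rw [hsq]
        ring
      simp only [hsum]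
      rw [radialTranslate, ← hw, smul_smul, mul_inv_cancel₀ h, one_smul, add_sub_cancel_right]
    · have hne : inner ℝ (radialTranslate v t x) w ^ 2 + 1 - ‖w‖ ^ 2 ≠ 0 := by
        nlinarith [norm_nonneg w, sq_nonneg (inner ℝ (radialTranslate v t x) w)]
      have h1 : DifferentiableAt ℝ (fun q : E n => inner ℝ q w) (radialTranslate v t x) :=
        differentiableAt_id.inner ℝ (differentiableAt_const w)
      exact ((h1.add ((((h1.pow 2).add_const 1).sub_const _).sqrt hne)).smul
        differentiableAt_id).sub_const w

/-! ### A quadratic shear followed by a weighted projection -/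

/-- The shear `x₁ ↦ x₁ + s (x₆² + x₇²)` followed by the projection to the unit sphere along the
orbits of the weighted dilations `(x₁, x₂, …, x₇) ↦ (r² x₁, r x₂, …, r x₇)`. -/
def shearPush (s : ℝ) (x : E 7) : E 7 :=
  let X := x 0 + s * (x 5 ^ 2 + x 6 ^ 2)
  let Y := x 1 ^ 2 + x 2 ^ 2 + x 3 ^ 2 + x 4 ^ 2 + x 5 ^ 2 + x 6 ^ 2
  let μ := Y + √(Y ^ 2 + 4 * X ^ 2)
  !₂[2 * X / μ, √(2 / μ) * x 1, √(2 / μ) * x 2, √(2 / μ) * x 3, √(2 / μ) * x 4, √(2 / μ) * x 5,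
    √(2 / μ) * x 6]

theorem sq_add_sq_shear_pos (s : ℝ) {x : E 7} (hx : x ∈ sphere (0 : E 7) 1) :
    0 < (x 1 ^ 2 + x 2 ^ 2 + x 3 ^ 2 + x 4 ^ 2 + x 5 ^ 2 + x 6 ^ 2) ^ 2 +
      4 * (x 0 + s * (x 5 ^ 2 + x 6 ^ 2)) ^ 2 := by
  rw [mem_unitSphere_iff] at hx
  rcases eq_or_ne (x 1 ^ 2 + x 2 ^ 2 + x 3 ^ 2 + x 4 ^ 2 + x 5 ^ 2 + x 6 ^ 2) 0 with h | h
  · have h5 : x 5 ^ 2 + x 6 ^ 2 = 0 := by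
      nlinarith [sq_nonneg (x 1), sq_nonneg (x 2), sq_nonneg (x 3), sq_nonneg (x 4),
        sq_nonneg (x 5), sq_nonneg (x 6)]
    rw [h, h5]
    nlinarith
  · have := sq_pos_of_ne_zero h
    positivity

theorem weight_pos (s : ℝ) {x : E 7} (hx : x ∈ sphere (0 : E 7) 1) :
    0 < x 1 ^ 2 + x 2 ^ 2 + x 3 ^ 2 + x 4 ^ 2 + x 5 ^ 2 + x 6 ^ 2 +
      √((x 1 ^ 2 + x 2 ^ 2 + x 3 ^ 2 + x 4 ^ 2 + x 5 ^ 2 + x 6 ^ 2) ^ 2 +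
        4 * (x 0 + s * (x 5 ^ 2 + x 6 ^ 2)) ^ 2) :=
  add_pos_of_nonneg_of_pos (by positivity) (Real.sqrt_pos.2 (sq_add_sq_shear_pos s hx))

theorem shearPush_mem (s : ℝ) {x : E 7} (hx : x ∈ sphere (0 : E 7) 1) :
    shearPush s x ∈ sphere (0 : E 7) 1 := by
  have hμ := weight_pos s hx
  have hR := Real.sq_sqrt (sq_add_sq_shear_pos s hx).le
  rw [mem_unitSphere_iff]
  simp only [shearPush, PiLp.toLp_apply, Matrix.cons_val]
  set X := x 0 + s * (x 5 ^ 2 + x 6 ^ 2)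
  set Y := x 1 ^ 2 + x 2 ^ 2 + x 3 ^ 2 + x 4 ^ 2 + x 5 ^ 2 + x 6 ^ 2 with hY
  set R := √(Y ^ 2 + 4 * X ^ 2)
  have hL : √(2 / (Y + R)) ^ 2 = 2 / (Y + R) := Real.sq_sqrt (by positivity)
  calc _ = (2 * X / (Y + R)) ^ 2 + √(2 / (Y + R)) ^ 2 * Y := by rw [hY]; ring
    _ = 1 := by
      rw [hL]
      field_simp
      linear_combination -hR

theorem shearPush_eq_of_weighted_dilation {s l : ℝ} (hl : 0 < l) {x y : E 7}
    (hx : x ∈ sphere (0 : E 7) 1) (h0 : y 0 + s * (y 5 ^ 2 + y 6 ^ 2) = l ^ 2 * x 0)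
    (hi : ∀ i, i ≠ 0 → y i = l * x i) : shearPush s y = x := by
  have hx' := mem_unitSphere_iff.1 hx
  have h1 := hi 1 (by decide)
  have h2 := hi 2 (by decide)
  have h3 := hi 3 (by decide)
  have h4 := hi 4 (by decide)
  have h5 := hi 5 (by decide)
  have h6 := hi 6 (by decide)
  have hY : y 1 ^ 2 + y 2 ^ 2 + y 3 ^ 2 + y 4 ^ 2 + y 5 ^ 2 + y 6 ^ 2 =
      l ^ 2 * (1 - x 0 ^ 2) := by
    rw [h1, h2, h3, h4, h5, h6]; linear_combination l ^ 2 * hx'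
  have hR : √((l ^ 2 * (1 - x 0 ^ 2)) ^ 2 + 4 * (l ^ 2 * x 0) ^ 2) = l ^ 2 * (1 + x 0 ^ 2) := by
    rw [Real.sqrt_eq_iff_mul_self_eq_of_pos (by positivity)]
    ring
  have hμ : l ^ 2 * (1 - x 0 ^ 2) + l ^ 2 * (1 + x 0 ^ 2) = 2 * l ^ 2 := by ring
  have hL : √(2 / (2 * l ^ 2)) = l⁻¹ := by
    rw [Real.sqrt_eq_iff_mul_self_eq_of_pos (by positivity)]
    field_simp
  ext i
  simp only [shearPush, PiLp.toLp_apply, h0, hY, hR, hμ, hL]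
  fin_cases i <;> simp [h1, h2, h3, h4, h5, h6] <;> field_simp

theorem shearPush_neg_shearPush (s : ℝ) {x : E 7} (hx : x ∈ sphere (0 : E 7) 1) :
    shearPush (-s) (shearPush s x) = x := by
  have hμ := weight_pos s hx
  refine shearPush_eq_of_weighted_dilation (Real.sqrt_pos.2 (div_pos two_pos hμ)) hx ?_ ?_
  · simp only [shearPush, PiLp.toLp_apply, Matrix.cons_val, mul_pow]
    rw [Real.sq_sqrt (by positivity)]
    ring
  · intro i hi
    fin_cases i <;> first | exact absurd rfl hi | rfl

theorem contDiffAt_shearPush (s t : ℝ) {x : E 7} (hx : x ∈ sphere (0 : E 7) 1) :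
    ContDiffAt ℝ ∞ (fun p : ℝ × E 7 => shearPush (p.1 * s) p.2) (t, x) := by
  have hμ := weight_pos (t * s) hx
  have hpos := sq_add_sq_shear_pos (t * s) hx
  have hc : ∀ i : Fin 7, ContDiffAt ℝ ∞ (fun p : ℝ × E 7 => p.2 i) (t, x) := fun i =>
    (contDiff_euclidean.1 contDiff_id i).contDiffAt.comp (t, x) contDiffAt_snd
  have h0 := hc 0
  have h1 := hc 1
  have h2 := hc 2
  have h3 := hc 3
  have h4 := hc 4
  have h5 := hc 5
  have h6 := hc 6
  have hX : ContDiffAt ℝ ∞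
      (fun p : ℝ × E 7 => p.2 0 + p.1 * s * (p.2 5 ^ 2 + p.2 6 ^ 2)) (t, x) := by fun_prop
  have hY : ContDiffAt ℝ ∞ (fun p : ℝ × E 7 =>
      p.2 1 ^ 2 + p.2 2 ^ 2 + p.2 3 ^ 2 + p.2 4 ^ 2 + p.2 5 ^ 2 + p.2 6 ^ 2) (t, x) := by fun_prop
  have hM := hY.add (((hY.pow 2).add (contDiffAt_const.mul (hX.pow 2))).sqrt hpos.ne')
  have hL := (contDiffAt_const.div hM hμ.ne').sqrt (div_pos two_pos hμ).ne'
  rw [contDiffAt_euclidean]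
  intro i
  fin_cases i
  · exact (contDiffAt_const.mul hX).div hM hμ.ne'
  · exact hL.mul h1
  · exact hL.mul h2
  · exact hL.mul h3
  · exact hL.mul h4
  · exact hL.mul h5
  · exact hL.mul h6

theorem isSphereIsotopy_shearPush (s : ℝ) : IsSphereIsotopy fun t => shearPush (t * s) where
  mapsTo t _ _ hx := shearPush_mem (t * s) hx
  contDiffAt t _ _ hx := contDiffAt_shearPush s t hx
  exists_leftInverse t _ := by
    refine ⟨shearPush (-(t * s)), fun x hx => ⟨shearPush_neg_shearPush _ hx, ?_⟩⟩
    have h := contDiffAt_shearPush (-(t * s)) 1 (shearPush_mem (t * s) hx)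
    have h' := h.comp (shearPush (t * s) x) (f := fun y : E 7 => ((1 : ℝ), y))
      (contDiffAt_const.prodMk contDiffAt_id)
    simpa [Function.comp_def] using h'.differentiableAt (by simp)

theorem shearPush_eq_self_of_mem_T (s : ℝ) {x : E 7} (hx : x ∈ T) : shearPush s x = x := by
  obtain ⟨hx, h1, h2⟩ := hx
  have hx' := mem_unitSphere_iff.1 hx
  have h5 : x 5 = 0 := by nlinarith [sq_nonneg (x 5), sq_nonneg (x 6)]
  have h6 : x 6 = 0 := by nlinarith [sq_nonneg (x 5), sq_nonneg (x 6)]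
  refine shearPush_eq_of_weighted_dilation one_pos hx ?_ fun i _ => (one_mul _).symm
  rw [h5, h6]
  ring

theorem shearPush_notMem_T (s : ℝ) {x : E 7} (hx : x ∈ sphere (0 : E 7) 1) (hxT : x ∉ T) :
    shearPush s x ∉ T := fun h => by
  refine hxT ?_
  rwa [← shearPush_neg_shearPush s hx, shearPush_eq_self_of_mem_T _ h]

/-! ### Boosts of the concentric spheres in the first three coordinates -/

/-- On each sphere `x₁² + x₂² + x₃² = r²` in the first three coordinates, this is the conformal map
pushing towards the pole `(r, 0, 0)` with rapidity `arsinh (k r)`. -/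
def boostPush (k : ℝ) (x : E 7) : E 7 :=
  let ρ := x 0 ^ 2 + x 1 ^ 2 + x 2 ^ 2
  let q := √(1 + k ^ 2 * ρ)
  let D := q + k * x 0
  !₂[(q * x 0 + k * ρ) / D, x 1 / D, x 2 / D, x 3, x 4, x 5, x 6]

theorem boost_denom_pos (k : ℝ) (x : E 7) :
    0 < √(1 + k ^ 2 * (x 0 ^ 2 + x 1 ^ 2 + x 2 ^ 2)) + k * x 0 := by
  have h : |k * x 0| < √(1 + k ^ 2 * (x 0 ^ 2 + x 1 ^ 2 + x 2 ^ 2)) := by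
    rw [← Real.sqrt_sq_eq_abs]
    refine Real.sqrt_lt_sqrt (sq_nonneg _) ?_
    nlinarith [sq_nonneg (k * x 1), sq_nonneg (k * x 2)]
  linarith [neg_abs_le (k * x 0)]

theorem boostPush_sum_sq (k : ℝ) (x : E 7) :
    boostPush k x 0 ^ 2 + boostPush k x 1 ^ 2 + boostPush k x 2 ^ 2 =
      x 0 ^ 2 + x 1 ^ 2 + x 2 ^ 2 := by
  have hD := boost_denom_pos k x
  have hq : √(1 + k ^ 2 * (x 0 ^ 2 + x 1 ^ 2 + x 2 ^ 2)) ^ 2 =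
    1 + k ^ 2 * (x 0 ^ 2 + x 1 ^ 2 + x 2 ^ 2) := Real.sq_sqrt (by positivity)
  simp only [boostPush, PiLp.toLp_apply, Matrix.cons_val]
  set q := √(1 + k ^ 2 * (x 0 ^ 2 + x 1 ^ 2 + x 2 ^ 2))
  rw [div_pow, div_pow, div_pow, ← add_div, ← add_div, div_eq_iff (pow_pos hD 2).ne']
  linear_combination (x 0 ^ 2 - (x 0 ^ 2 + x 1 ^ 2 + x 2 ^ 2)) * hq

theorem boostPush_mem (k : ℝ) {x : E 7} (hx : x ∈ sphere (0 : E 7) 1) :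
    boostPush k x ∈ sphere (0 : E 7) 1 := by
  rw [mem_unitSphere_iff] at hx ⊢
  rw [boostPush_sum_sq]
  exact hx

theorem boostPush_notMem_T (k : ℝ) {x : E 7} (hx : x ∈ sphere (0 : E 7) 1) (hxT : x ∉ T) :
    boostPush k x ∉ T := fun ⟨_, h1, h2⟩ =>
  hxT ⟨hx, by rwa [boostPush_sum_sq] at h1, h2⟩

theorem boostPush_neg_boostPush (k : ℝ) (x : E 7) : boostPush (-k) (boostPush k x) = x := by
  have hD := boost_denom_pos k x
  have hq : √(1 + k ^ 2 * (x 0 ^ 2 + x 1 ^ 2 + x 2 ^ 2)) ^ 2 =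
    1 + k ^ 2 * (x 0 ^ 2 + x 1 ^ 2 + x 2 ^ 2) := Real.sq_sqrt (by positivity)
  have h0 : boostPush k x 0 = (√(1 + k ^ 2 * (x 0 ^ 2 + x 1 ^ 2 + x 2 ^ 2)) * x 0 +
    k * (x 0 ^ 2 + x 1 ^ 2 + x 2 ^ 2)) /
      (√(1 + k ^ 2 * (x 0 ^ 2 + x 1 ^ 2 + x 2 ^ 2)) + k * x 0) := rfl
  have h1 : boostPush k x 1 = x 1 / (√(1 + k ^ 2 * (x 0 ^ 2 + x 1 ^ 2 + x 2 ^ 2)) + k * x 0) := rfl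
  have h2 : boostPush k x 2 = x 2 / (√(1 + k ^ 2 * (x 0 ^ 2 + x 1 ^ 2 + x 2 ^ 2)) + k * x 0) := rfl
  have hden : √(1 + k ^ 2 * (x 0 ^ 2 + x 1 ^ 2 + x 2 ^ 2)) + -k * boostPush k x 0 =
      (√(1 + k ^ 2 * (x 0 ^ 2 + x 1 ^ 2 + x 2 ^ 2)) + k * x 0)⁻¹ := by
    rw [h0]
    field_simp
    linear_combination hq
  have hnum : √(1 + k ^ 2 * (x 0 ^ 2 + x 1 ^ 2 + x 2 ^ 2)) * boostPush k x 0 +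
      -k * (x 0 ^ 2 + x 1 ^ 2 + x 2 ^ 2) =
      x 0 * (√(1 + k ^ 2 * (x 0 ^ 2 + x 1 ^ 2 + x 2 ^ 2)) + k * x 0)⁻¹ := by
    rw [h0]
    field_simp
    linear_combination x 0 * hq
  ext i
  rw [boostPush]
  simp only [boostPush_sum_sq, neg_sq, hden, hnum]
  fin_cases i
  · simp [hD.ne']
  · simp [h1, hD.ne']
  · simp [h2, hD.ne']
  all_goals rfl

theorem contDiff_boostPush (k : ℝ) :
    ContDiff ℝ ∞ (fun p : ℝ × E 7 => boostPush (p.1 * k) p.2) := by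
  have hc : ∀ i : Fin 7, ContDiff ℝ ∞ (fun p : ℝ × E 7 => p.2 i) := fun i =>
    (contDiff_euclidean.1 contDiff_id i).comp contDiff_snd
  have h0 := hc 0
  have h1 := hc 1
  have h2 := hc 2
  have hρ : ContDiff ℝ ∞ (fun p : ℝ × E 7 => p.2 0 ^ 2 + p.2 1 ^ 2 + p.2 2 ^ 2) := by fun_prop
  have hk : ContDiff ℝ ∞ (fun p : ℝ × E 7 => p.1 * k) := by fun_prop
  have hq := (contDiff_const.add ((hk.pow 2).mul hρ)).sqrt
    fun p => (show 0 < 1 + (p.1 * k) ^ 2 * (p.2 0 ^ 2 + p.2 1 ^ 2 + p.2 2 ^ 2) by positivity).ne'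
  have hD := hq.add (hk.mul h0)
  have hne := fun p : ℝ × E 7 => (boost_denom_pos (p.1 * k) p.2).ne'
  rw [contDiff_euclidean]
  intro i
  fin_cases i
  · exact ((hq.mul h0).add (hk.mul hρ)).div hD hne
  · exact h1.div hD hne
  · exact h2.div hD hne
  · exact hc 3
  · exact hc 4
  · exact hc 5
  · exact hc 6

theorem isSphereIsotopy_boostPush (k : ℝ) : IsSphereIsotopy fun t => boostPush (t * k) where
  mapsTo t _ _ hx := boostPush_mem (t * k) hx
  contDiffAt _ _ _ _ := (contDiff_boostPush k).contDiffAt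
  exists_leftInverse t _ := by
    refine ⟨boostPush (-(t * k)), fun x _ => ⟨boostPush_neg_boostPush _ x, ?_⟩⟩
    have h := (contDiff_boostPush (-(t * k))).comp
      (contDiff_const.prodMk contDiff_id : ContDiff ℝ ∞ fun y : E 7 => ((1 : ℝ), y))
    simpa [Function.comp_def] using h.contDiffAt.differentiableAt (by simp)

/-! ### Pushing compact sets into the upper hemisphere -/

/-- A compact set disjoint from `{x₂ = x₃ = x₆ = x₇ = 0}` can be pushed off
`{x₁ ≤ 0, x₂ = x₃ = 0}`. -/
theorem exists_shearPush {K : Set (E 7)} (hK : IsCompact K) (hKS : K ⊆ sphere (0 : E 7) 1)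
    (hne : ∀ x ∈ K, x 1 = 0 → x 2 = 0 → 0 < x 5 ^ 2 + x 6 ^ 2) :
    ∃ s : ℝ, ∀ x ∈ K, shearPush s x 1 = 0 → shearPush s x 2 = 0 → 0 < shearPush s x 0 := by
  have hK₀ : IsCompact (K ∩ {x | x 1 = 0 ∧ x 2 = 0}) :=
    hK.inter_right ((isClosed_eq (by fun_prop) (by fun_prop)).inter
      (isClosed_eq (by fun_prop) (by fun_prop)))
  obtain ⟨δ, hδ, hδK⟩ : ∃ δ : ℝ, 0 < δ ∧
      ∀ x ∈ K ∩ {x | x 1 = 0 ∧ x 2 = 0}, δ ≤ x 5 ^ 2 + x 6 ^ 2 :=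
    hK₀.exists_forall_le' (f := fun x : E 7 => x 5 ^ 2 + x 6 ^ 2) (by fun_prop)
      fun x hx => hne x hx.1 hx.2.1 hx.2.2
  refine ⟨2 / δ, fun x hx h1 h2 => ?_⟩
  have hμ := weight_pos (2 / δ) (hKS hx)
  have hL := (Real.sqrt_pos.2 (div_pos two_pos hμ)).ne'
  have h1' : x 1 = 0 := (mul_eq_zero.1 h1).resolve_left hL
  have h2' : x 2 = 0 := (mul_eq_zero.1 h2).resolve_left hL
  have hc := hδK x ⟨hx, h1', h2'⟩
  have hx0 : -1 ≤ x 0 := by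
    nlinarith [mem_unitSphere_iff.1 (hKS hx), sq_nonneg (x 3), sq_nonneg (x 4),
        sq_nonneg (x 5), sq_nonneg (x 6), sq_nonneg (x 1), sq_nonneg (x 2)]
  have h2δ : 2 ≤ 2 / δ * (x 5 ^ 2 + x 6 ^ 2) := by
    rw [div_mul_eq_mul_div, le_div_iff₀ hδ]
    linarith
  exact div_pos (by linarith) hμ

/-- A compact set disjoint from `{x₁ ≤ 0, x₂ = x₃ = 0}` can be pushed into the open upper
hemisphere. -/
theorem exists_boostPush {K : Set (E 7)} (hK : IsCompact K) (hKS : K ⊆ sphere (0 : E 7) 1)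
    (hne : ∀ x ∈ K, x 1 = 0 → x 2 = 0 → 0 < x 0) :
    ∃ k : ℝ, ∀ x ∈ K, 0 < boostPush k x 0 := by
  have hK₀ : IsCompact (K ∩ {x | x 0 ≤ 0}) :=
    hK.inter_right (isClosed_le (by fun_prop) (by fun_prop))
  obtain ⟨δ, hδ, hδK⟩ : ∃ δ : ℝ, 0 < δ ∧ ∀ x ∈ K ∩ {x | x 0 ≤ 0}, δ ≤ x 1 ^ 2 + x 2 ^ 2 :=
    hK₀.exists_forall_le' (f := fun x : E 7 => x 1 ^ 2 + x 2 ^ 2) (by fun_prop) fun x hx => by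
      by_contra! h
      have h1 : x 1 = 0 := by nlinarith [sq_nonneg (x 1), sq_nonneg (x 2)]
      have h2 : x 2 = 0 := by nlinarith [sq_nonneg (x 1), sq_nonneg (x 2)]
      exact (hne x hx.1 h1 h2).not_ge hx.2
  refine ⟨2 / δ, fun x hx => div_pos ?_ (boost_denom_pos _ x)⟩
  have hk : 0 < 2 / δ := by positivity
  generalize hkdef : 2 / δ = k at hk
  have hkδ : k * δ = 2 := by rw [← hkdef]; field_simp
  rcases lt_or_ge 0 (x 0) with h0 | h0
  · positivity
  · have hc := hδK x ⟨hx, h0⟩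
    have hx1 : x 0 ^ 2 ≤ 1 := by
      nlinarith [mem_unitSphere_iff.1 (hKS hx), sq_nonneg (x 3), sq_nonneg (x 4),
        sq_nonneg (x 5), sq_nonneg (x 6), sq_nonneg (x 1), sq_nonneg (x 2)]
    have hlt : √(1 + k ^ 2 * (x 0 ^ 2 + x 1 ^ 2 + x 2 ^ 2)) * -x 0 <
        k * (x 0 ^ 2 + x 1 ^ 2 + x 2 ^ 2) := by
      refine lt_of_pow_lt_pow_left₀ 2 (by positivity) ?_
      rw [mul_pow, Real.sq_sqrt (by positivity)]
      have hkc : 2 ≤ k * (x 1 ^ 2 + x 2 ^ 2) := by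
        rw [← hkδ]; exact mul_le_mul_of_nonneg_left hc hk.le
      nlinarith [mul_nonneg (sq_nonneg (k * x 0)) (by positivity : 0 ≤ x 1 ^ 2 + x 2 ^ 2)]
    linarith

/-! ### General position -/

/-- The complement of the image of a smooth map from the `n`-sphere to a space of larger dimension
is dense. -/
theorem dense_compl_range_of_contMDiff_sphere {n : ℕ} {F : Type*} [NormedAddCommGroup F]
    [NormedSpace ℝ F] [FiniteDimensional ℝ F] (hn : n < Module.finrank ℝ F) {g : Sph n → F}
    (hg : ContMDiff (𝓡 n) 𝓘(ℝ, F) 1 g) : Dense (range g)ᶜ := by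
  have : Fact (Module.finrank ℝ (E (n + 1)) = n + 1) := ⟨finrank_euclideanSpace_fin⟩
  let p : Sph n := ⟨EuclideanSpace.single 0 1, by simp⟩
  let e := stereographic' n p
  have hsmooth : ContDiff ℝ 1 (g ∘ e.symm) := by
    rw [← contMDiff_iff_contDiff, ← contMDiffOn_univ]
    have h := contMDiffOn_chart_symm (I := 𝓡 n) (n := 1) (x := -p)
    have he : chartAt (E n) (-p) = e := by
      change stereographic' n (- -p) = _
      rw [neg_neg]
    rw [he, stereographic'_target] at h
    exact hg.comp_contMDiffOn h
  refine dense_compl_of_dimH_lt_finrank ?_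
  have hsub : range g ⊆ range (g ∘ e.symm) ∪ {g p} := by
    rintro _ ⟨x, rfl⟩
    by_cases hx : x = p
    · exact Or.inr (by rw [hx]; rfl)
    · refine Or.inl ⟨e x, ?_⟩
      rw [Function.comp_apply, e.left_inv (by simpa [e] using hx)]
  refine (dimH_mono hsub).trans_lt ?_
  rw [dimH_union, dimH_singleton, max_lt_iff]
  have hpos : 0 < Module.finrank ℝ F := by omega
  refine ⟨hsmooth.dimH_range_le.trans_lt ?_, by exact_mod_cast hpos⟩
  rw [finrank_euclideanSpace_fin]
  exact_mod_cast hn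

theorem isClosed_T : IsClosed T :=
  isClosed_sphere.inter ((isClosed_eq (by fun_prop) (by fun_prop)).inter
    (isClosed_eq (by fun_prop) (by fun_prop)))

/-- Small translations followed by radial projection keep a compact subset of the sphere disjoint
from `T`. -/
theorem exists_forall_radialTranslate_notMem_T {K : Set (E 7)} (hK : IsCompact K)
    (hKS : K ⊆ sphere (0 : E 7) 1) (hKT : ∀ x ∈ K, x ∉ T) :
    ∃ ε > 0, ∀ v : E 7, ‖v‖ < ε → ∀ t ∈ Icc (0 : ℝ) 1, ∀ x ∈ K, radialTranslate v t x ∉ T := by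
  have hcont : ContinuousOn (fun w : E 7 => ‖w‖⁻¹ • w) {0}ᶜ :=
    (continuousOn_id.norm.inv₀ fun w hw => norm_ne_zero_iff.2 hw).smul continuousOn_id
  have hopen := hcont.isOpen_inter_preimage isOpen_compl_singleton isClosed_T.isOpen_compl
  obtain ⟨ε, hε, hsub⟩ := hK.exists_thickening_subset_open hopen fun x hx => by
    have hx1 : ‖x‖ = 1 := mem_sphere_zero_iff_norm.1 (hKS hx)
    refine ⟨norm_ne_zero_iff.1 (by simp [hx1]), ?_⟩
    simpa [hx1] using hKT x hx
  refine ⟨ε, hε, fun v hv t ht x hx => (hsub (mem_thickening_iff.2 ⟨x, hx, ?_⟩)).2⟩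
  rw [dist_eq_norm, add_sub_cancel_left, norm_smul, Real.norm_of_nonneg ht.1]
  nlinarith [norm_nonneg v, ht.1, ht.2]

/-- The coordinates `x₂, x₃, x₆, x₇`. -/
def transverseCoords (x : E 7) : E 4 := !₂[x 1, x 2, x 5, x 6]

/-- The vector with prescribed coordinates `x₂, x₃, x₆, x₇` and all other coordinates zero. -/
def transverseVector (w : E 4) : E 7 := !₂[0, w 0, w 1, 0, 0, w 2, w 3]

theorem norm_transverseVector (w : E 4) : ‖transverseVector w‖ = ‖w‖ := by
  rw [EuclideanSpace.norm_eq, EuclideanSpace.norm_eq]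
  simp [transverseVector, Fin.sum_univ_succ]

/-- A smooth map from the 3-sphere to `ℝ⁷` can be translated by an arbitrarily small vector off
`{x₂ = x₃ = x₆ = x₇ = 0}`. -/
theorem exists_small_translate {f : Sph 3 → E 7} (hf : ContMDiff (𝓡 3) 𝓘(ℝ, E 7) 1 f) {ε : ℝ}
    (hε : 0 < ε) : ∃ v : E 7, ‖v‖ < ε ∧ ∀ x, transverseCoords (f x + v) ≠ 0 := by
  have hlin : ContDiff ℝ 1 (fun y : E 7 => -transverseCoords y) := by
    have hc : ∀ i : Fin 7, ContDiff ℝ 1 (fun y : E 7 => y i) := contDiff_euclidean.1 contDiff_id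
    rw [contDiff_euclidean]
    intro i
    fin_cases i
    · exact (hc 1).neg
    · exact (hc 2).neg
    · exact (hc 5).neg
    · exact (hc 6).neg
  have hdense := dense_compl_range_of_contMDiff_sphere (n := 3) (F := E 4) (by simp)
    (hlin.contMDiff.comp hf)
  obtain ⟨w, hw, hwε⟩ := hdense.exists_dist_lt 0 hε
  rw [dist_zero_left] at hwε
  refine ⟨transverseVector w, by rwa [norm_transverseVector], fun x hx => hw ⟨x, ?_⟩⟩
  have h : transverseCoords (f x + transverseVector w) = transverseCoords (f x) + w := by
    ext i
    fin_cases i <;> rfl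
  rw [h] at hx
  exact neg_eq_of_add_eq_zero_right hx

theorem statement11 (f : Sph 3 → Sph 6) (hf : IsSmoothEmbedding f)
    (hT : ∀ x, (f x : E 7) ∉ T) :
    ∃ H : Set.Icc (0 : ℝ) 1 × Sph 3 → Sph 6,
      ContMDiff ((𝓡∂ 1).prod (𝓡 3)) (𝓡 6) (⊤ : ℕ∞) H ∧
      (∀ t : Set.Icc (0 : ℝ) 1, IsSmoothEmbedding fun x => H (t, x)) ∧
      (∀ (t : Set.Icc (0 : ℝ) 1) (x : Sph 3), (H (t, x) : E 7) ∉ T) ∧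
      (∀ x, H (⟨0, by norm_num⟩, x) = f x) ∧
      (∀ x : Sph 3, 0 < (H (⟨1, by norm_num⟩, x) : E 7) 0) := by
  have : Fact (Module.finrank ℝ (E 7) = 6 + 1) := ⟨finrank_euclideanSpace_fin⟩
  have hval : ContMDiff (𝓡 3) 𝓘(ℝ, E 7) ∞ fun x => (f x : E 7) :=
    contMDiff_coe_sphere.comp hf.1
  have hK : IsCompact (range fun x => (f x : E 7)) := isCompact_range hval.continuous
  obtain ⟨ε, hε, hεT⟩ := exists_forall_radialTranslate_notMem_T hK
    (range_subset_iff.2 fun x => (f x).2) (forall_mem_range.2 hT)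
  obtain ⟨v, hv, hvf⟩ := exists_small_translate (hval.of_le (by simp)) (lt_min hε one_pos)
  have hF₁ := isSphereIsotopy_radialTranslate (hv.trans_le (min_le_right _ _))
  have one_mem : (1 : ℝ) ∈ Icc (0 : ℝ) 1 := right_mem_Icc.2 zero_le_one
  have zero_mem : (0 : ℝ) ∈ Icc (0 : ℝ) 1 := left_mem_Icc.2 zero_le_one
  have hcont : ∀ {F : ℝ → E 7 → E 7}, IsSphereIsotopy F →
      Continuous fun x => F 1 (f x) := fun hF => continuous_iff_continuousAt.2 fun x =>
    (hF.contDiffAt 1 one_mem _ (f x).2).continuousAt.comp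
      (f := fun x => ((1 : ℝ), (f x : E 7))) (continuous_const.prodMk hval.continuous).continuousAt
  obtain ⟨s, hs⟩ := exists_shearPush (isCompact_range (hcont hF₁))
    (range_subset_iff.2 fun x => hF₁.mapsTo 1 one_mem (f x).2) <| by
      rintro _ ⟨x, rfl⟩ h1 h2
      by_contra! h
      refine hvf x ?_
      have hne : ‖(f x : E 7) + v‖⁻¹ ≠ 0 := inv_ne_zero <| norm_ne_zero_iff.2 <|
        add_ne_zero_of_norm_lt_one (hv.trans_le (min_le_right _ _)) (f x).2
      have hcoord : ∀ i, radialTranslate v 1 (f x) i = 0 → ((f x : E 7) + v) i = 0 := fun i hi => by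
        rw [radialTranslate, one_smul, PiLp.smul_apply, smul_eq_mul] at hi
        exact (mul_eq_zero.1 hi).resolve_left hne
      have h5 : radialTranslate v 1 (f x) 5 = 0 := by
        nlinarith [sq_nonneg (radialTranslate v 1 (f x) 5), sq_nonneg (radialTranslate v 1 (f x) 6)]
      have h6 : radialTranslate v 1 (f x) 6 = 0 := by
        nlinarith [sq_nonneg (radialTranslate v 1 (f x) 5), sq_nonneg (radialTranslate v 1 (f x) 6)]
      ext i
      fin_cases i
      exacts [hcoord 1 h1, hcoord 2 h2, hcoord 5 h5, hcoord 6 h6]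
  have hF₂ := (isSphereIsotopy_shearPush s).comp hF₁
  obtain ⟨k, hk⟩ := exists_boostPush (isCompact_range (hcont hF₂))
    (range_subset_iff.2 fun x => hF₂.mapsTo 1 one_mem (f x).2) <| by
      rintro _ ⟨x, rfl⟩
      simpa only [one_mul] using hs _ (mem_range_self x)
  have hF₃ := (isSphereIsotopy_boostPush k).comp hF₂
  obtain ⟨H, hH, hemb, hHF⟩ := hF₃.exists_isotopy hf
  refine ⟨H, hH, hemb, fun t x => ?_, fun x => Subtype.ext ?_, fun x => ?_⟩
  · rw [hHF]
    have h₁ := hεT v (hv.trans_le (min_le_left _ _)) t t.2 _ (mem_range_self x)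
    exact boostPush_notMem_T _ (hF₂.mapsTo t t.2 (f x).2)
      (shearPush_notMem_T _ (hF₁.mapsTo t t.2 (f x).2) h₁)
  · rw [hHF]
    have hx : ‖(f x : E 7)‖ = 1 := mem_sphere_zero_iff_norm.1 (f x).2
    have h₁ : radialTranslate v 0 (f x) = f x := by simp [radialTranslate, hx]
    have h₂ : shearPush 0 (f x) = f x :=
      shearPush_eq_of_weighted_dilation one_pos (f x).2 (by ring) fun i _ => (one_mul _).symm
    have h₃ : boostPush 0 (f x) = f x := by
      ext i
      fin_cases i <;> simp [boostPush]
    simp only [zero_mul, h₁, h₂, h₃]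
  · rw [hHF]
    simpa only [one_mul] using hk _ (mem_range_self x)
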